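/- For every π ∈ (0, 1), the function ψ_π is convex on [0, 1]: for all Δ₁, Δ₂ ∈ [0, 1] and all t ∈ [0, 1], ψ_π(t·Δ₁ + (1−t)·Δ₂) ≤ t·ψ_π(Δ₁) + (1−t)·ψ_π(Δ₂). -/

import Mathlib

open Real

/-- First branch of Gupta et al.'s helper function `f`. -/
noncomputable def g1 (V : ℝ) : ℝ := Real.log ((2 + V) / (2 - V)) - 2 * V / (2 + V)

/-- Gupta et al.'s helper function `f`. -/
noncomputable def f (V : ℝ) : ℝ := max (g1 V) (V ^ 2 / 2 + V ^ 4 / 36 + V ^ 6 / 288)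

/-- Gupta et al.'s bound `ψ` for a binary sensitive attribute with `ℙ(S = 1) = p`. -/
noncomputable def psi (p Δ : ℝ) : ℝ := (1 - p) * f (p * Δ) + p * f ((1 - p) * Δ)

/-- The first derivative of `g1` in partial fractions. -/
lemma hasDerivAt_g1 {V : ℝ} (h0 : -2 < V) (h2 : V < 2) :
    HasDerivAt g1 (1 / (2 + V) + 1 / (2 - V) - 4 / (2 + V) ^ 2) V := by
  have hp : 2 + V ≠ 0 := by linarith
  have hm : 2 - V ≠ 0 := by linarith
  have dp : HasDerivAt (fun x : ℝ => 2 + x) 1 V := (hasDerivAt_id V).const_add 2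
  have dm : HasDerivAt (fun x : ℝ => 2 - x) (-1) V := (hasDerivAt_id V).const_sub 2
  have dn : HasDerivAt (fun x : ℝ => 2 * x) (2 * 1) V := (hasDerivAt_id V).const_mul 2
  have h := ((dp.div dm hm).log (div_ne_zero hp hm)).sub (dn.div dp hp)
  refine h.congr_deriv ?_
  simp only [Pi.div_apply]
  field_simp
  ring

lemma hasDerivAt_deriv_g1 {V : ℝ} (h0 : -2 < V) (h2 : V < 2) :
    HasDerivAt (fun x : ℝ => 1 / (2 + x) + 1 / (2 - x) - 4 / (2 + x) ^ 2)
      (1 / (2 - V) ^ 2 - 1 / (2 + V) ^ 2 + 8 / (2 + V) ^ 3) V := by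
  have hp : 2 + V ≠ 0 := by linarith
  have hm : 2 - V ≠ 0 := by linarith
  have dp : HasDerivAt (fun x : ℝ => 2 + x) 1 V := (hasDerivAt_id V).const_add 2
  have dm : HasDerivAt (fun x : ℝ => 2 - x) (-1) V := (hasDerivAt_id V).const_sub 2
  have h := (((hasDerivAt_const V (1 : ℝ)).div dp hp).add
    ((hasDerivAt_const V (1 : ℝ)).div dm hm)).sub
    ((hasDerivAt_const V (4 : ℝ)).div (dp.pow 2) (pow_ne_zero 2 hp))
  refine h.congr_deriv ?_
  simp only [Pi.pow_apply]
  field_simp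
  ring

lemma convexOn_g1 : ConvexOn ℝ (Set.Ico 0 2) g1 := by
  refine convexOn_of_hasDerivWithinAt2_nonneg (convex_Ico 0 2)
    (f' := fun x : ℝ => 1 / (2 + x) + 1 / (2 - x) - 4 / (2 + x) ^ 2)
    (f'' := fun x : ℝ => 1 / (2 - x) ^ 2 - 1 / (2 + x) ^ 2 + 8 / (2 + x) ^ 3)
    (fun x hx => (hasDerivAt_g1 (by linarith [hx.1]) hx.2).continuousAt.continuousWithinAt)
    ?_ ?_ ?_ <;> intro x hx <;> rw [interior_Ico] at hx <;> obtain ⟨h0, h2⟩ := hx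
  · exact (hasDerivAt_g1 (by linarith) h2).hasDerivWithinAt
  · exact (hasDerivAt_deriv_g1 (by linarith) h2).hasDerivWithinAt
  · have hle : 1 / (2 + x) ^ 2 ≤ 1 / (2 - x) ^ 2 :=
      one_div_le_one_div_of_le (by nlinarith) (by nlinarith)
    have : 0 ≤ 8 / (2 + x) ^ 3 := by positivity
    linarith

lemma convexOn_f : ConvexOn ℝ (Set.Ico 0 2) f := by
  have hpow (n : ℕ) : ConvexOn ℝ (Set.Ico (0 : ℝ) 2) (fun V => V ^ n) :=
    (convexOn_pow n).subset (fun _ hx => hx.1) (convex_Ico 0 2)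
  have hpoly : ConvexOn ℝ (Set.Ico (0 : ℝ) 2)
      (fun V => V ^ 2 / 2 + V ^ 4 / 36 + V ^ 6 / 288) := by
    have h := (((hpow 2).smul (c := 1 / 2) (by norm_num)).add
      ((hpow 4).smul (c := 1 / 36) (by norm_num))).add
      ((hpow 6).smul (c := 1 / 288) (by norm_num))
    refine h.congr fun x _ => ?_
    simp only [Pi.add_apply, smul_eq_mul]
    ring
  exact convexOn_g1.sup hpoly

/-- for every `p ∈ (0, 1)`, `ψ_p` is convex on `[0, 1]`. -/
theorem psi_convexOn :
    ∀ p : ℝ, 0 < p → p < 1 →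
      ∀ Δ₁ Δ₂ : ℝ, 0 ≤ Δ₁ → Δ₁ ≤ 1 → 0 ≤ Δ₂ → Δ₂ ≤ 1 →
        ∀ t : ℝ, 0 ≤ t → t ≤ 1 →
          psi p (t * Δ₁ + (1 - t) * Δ₂) ≤ t * psi p Δ₁ + (1 - t) * psi p Δ₂ := by
  intro p hp0 hp1 x y hx0 hx1 hy0 hy1 t ht0 ht1
  have scaled (c : ℝ) (hc0 : 0 < c) (hc1 : c < 1) :
      f (c * (t * x + (1 - t) * y)) ≤ t * f (c * x) + (1 - t) * f (c * y) := by
    have h := convexOn_f.2 (x := c * x) (y := c * y) ⟨by positivity, by nlinarith⟩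
      ⟨by positivity, by nlinarith⟩ ht0 (sub_nonneg.2 ht1) (by ring)
    simp only [smul_eq_mul] at h
    rwa [show t * (c * x) + (1 - t) * (c * y) = c * (t * x + (1 - t) * y) by ring] at h
  have h1 := mul_le_mul_of_nonneg_left (scaled p hp0 hp1) (sub_pos.2 hp1).le
  have h2 := mul_le_mul_of_nonneg_left (scaled (1 - p) (by linarith) (by linarith)) hp0.le
  unfold psi
  linarith
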